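/- (Effective bulk modulus in uniaxial tension.) Let K > 0, η ∈ ℝ, and 0 ≤ d_H < 1/3. Let Φ = diag((1 − 3d_H)^{−1/2}, 1, 1), and let g(Φ) = (1 − η) + η[(1/10)(tr Φ)² + (1/30)tr(Φ²)]. Then the effective bulk modulus K̃ = K / g(Φ) satisfies K̃ = 5K(1 − 3d_H) / [5 − (15 − 8η)d_H − 2η(1 − √(1 − 3d_H))]. Moreover, for η > 0 the right-hand side extends continuously to d_H = 1/3 (i.e., maximal principal damage d₁ = 1) with value 0, the denominator there being 2η/3 > 0. -/

import Mathlib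

open Matrix Filter

/-- **Effective bulk modulus in uniaxial tension.** With `Φ = diag((1−3d_H)^{−1/2}, 1, 1)` and
`g(Φ) = (1−η) + η[(1/10)(tr Φ)² + (1/30)tr(Φ²)]`, the effective bulk modulus `K̃ = K/g(Φ)`
equals `5K(1−3d_H)/[5 − (15−8η)d_H − 2η(1−√(1−3d_H))]`; for `η > 0` this expression tends
to `0` as `d_H → (1/3)⁻` (maximal principal damage `d₁ = 1`), the denominator there being
`2η/3 > 0`. -/
theorem effective_bulk_modulus_uniaxial
    (K η dH : ℝ) (hK : 0 < K) (h0 : 0 ≤ dH) (h1 : dH < 1 / 3)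
    (Φ : Matrix (Fin 3) (Fin 3) ℝ)
    (hΦ : Φ = Matrix.diagonal ![(1 - 3 * dH) ^ (-(1 / 2) : ℝ), 1, 1])
    (g : ℝ)
    (hg : g = (1 - η) + η * (1 / 10 * Φ.trace ^ 2 + 1 / 30 * (Φ * Φ).trace)) :
    K / g = 5 * K * (1 - 3 * dH) /
        (5 - (15 - 8 * η) * dH - 2 * η * (1 - Real.sqrt (1 - 3 * dH))) ∧
      (0 < η →
        5 - (15 - 8 * η) * (1 / 3) - 2 * η * (1 - Real.sqrt (1 - 3 * (1 / 3)))
            = 2 * η / 3 ∧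
          0 < 2 * η / 3 ∧
          Tendsto (fun d : ℝ => 5 * K * (1 - 3 * d) /
              (5 - (15 - 8 * η) * d - 2 * η * (1 - Real.sqrt (1 - 3 * d))))
            (nhdsWithin (1 / 3) (Set.Ico 0 (1 / 3))) (nhds 0)) := by
  have hs : 0 < Real.sqrt (1 - 3 * dH) := Real.sqrt_pos.2 (by linarith)
  have hsq : Real.sqrt (1 - 3 * dH) ^ 2 = 1 - 3 * dH := Real.sq_sqrt (by linarith)
  have hpow : (1 - 3 * dH) ^ (-(1 / 2) : ℝ) = (Real.sqrt (1 - 3 * dH))⁻¹ := by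
    rw [Real.rpow_neg (by linarith), Real.sqrt_eq_rpow]
  constructor
  · have hden : 5 - (15 - 8 * η) * dH - 2 * η * (1 - Real.sqrt (1 - 3 * dH))
        = (5 * (1 - 3 * dH)) * g := by
      rw [hg, hΦ, hpow, Matrix.diagonal_mul_diagonal, Matrix.trace_diagonal,
        Matrix.trace_diagonal]
      simp only [Fin.sum_univ_three, Matrix.cons_val]
      generalize Real.sqrt (1 - 3 * dH) = s at hs hsq
      obtain rfl : dH = (1 - s ^ 2) / 3 := by linarith
      field_simp
      ring
    rw [hden, mul_right_comm, mul_div_mul_left]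
    exact (by linarith : (0 : ℝ) < 5 * (1 - 3 * dH)).ne'
  · intro hη
    have hval : 5 - (15 - 8 * η) * (1 / 3) - 2 * η * (1 - Real.sqrt (1 - 3 * (1 / 3)))
        = 2 * η / 3 := by
      norm_num
      ring
    have hpos : 0 < 2 * η / 3 := by positivity
    refine ⟨hval, hpos, ?_⟩
    have hcont : ContinuousAt (fun d : ℝ => 5 * K * (1 - 3 * d) /
        (5 - (15 - 8 * η) * d - 2 * η * (1 - Real.sqrt (1 - 3 * d)))) (1 / 3) := by
      refine ContinuousAt.div (by fun_prop) (by fun_prop) ?_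
      rw [hval]
      exact hpos.ne'
    have hlim := hcont.tendsto
    norm_num only [mul_zero, zero_div] at hlim
    simpa using hlim.mono_left nhdsWithin_le_nhds
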